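/- arXiv:cs/0203005 — 2 statements merged into one kernel-verified Lean document; each statement's English description precedes it below -/
import Mathlib

section
/- Let (Π,<) be a statically ordered logic program and X a set of literals. If X = Y ∩ 𝓛_𝒜 for some answer set Y of 𝒯(Π,<), then X is an answer set of Π, where 𝓛_𝒜 denotes the set of literals over the regular atoms 𝒜. -/
set_option autoImplicit false

namespace ASP

/-- Literals over a set of atoms: an atom or its classical negation. -/
inductive Lit (α : Type) : Type
  | pos : α → Lit α
  | neg : α → Lit α

namespace Lit

/-- The atom of a literal. -/
def atom {α : Type} : Lit α → α
  | pos a => a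
  | neg a => a

/-- Map a function over the atom of a literal. -/
def map {α β : Type} (f : α → β) : Lit α → Lit β
  | pos a => pos (f a)
  | neg a => neg (f a)

end Lit

/-- A rule `head ← bodyP, not bodyN`. -/
structure Rule (α : Type) : Type where
  head : Lit α
  bodyP : Set (Lit α)
  bodyN : Set (Lit α)

/-- Map a function over the atoms of a rule. -/
def Rule.map {α β : Type} (f : α → β) (r : Rule α) : Rule β :=
  ⟨r.head.map f, Lit.map f '' r.bodyP, Lit.map f '' r.bodyN⟩

/-- The literals occurring in a rule. -/
def ruleLits {α : Type} (r : Rule α) : Set (Lit α) := insert r.head (r.bodyP ∪ r.bodyN)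

/-- A set of literals is consistent iff it contains no complementary pair. -/
def consistent {α : Type} (X : Set (Lit α)) : Prop := ¬ ∃ a, Lit.pos a ∈ X ∧ Lit.neg a ∈ X

/-- Logically closed: consistent or the set of all literals. -/
def logClosed {α : Type} (X : Set (Lit α)) : Prop := consistent X ∨ X = Set.univ

/-- The smallest logically closed set of literals containing `S`. -/
def logClosure {α : Type} (S : Set (Lit α)) : Set (Lit α) := ⋂₀ {Y | S ⊆ Y ∧ logClosed Y}

/-- `X` is closed under the (basic) program `P`. -/
def closedUnder {α : Type} (P : Set (Rule α)) (X : Set (Lit α)) : Prop :=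
  ∀ r ∈ P, r.bodyP ⊆ X → r.head ∈ X

/-- `Th P`: smallest set which is logically closed and closed under the basic program `P`. -/
def Th {α : Type} (P : Set (Rule α)) : Set (Lit α) := ⋂₀ {X | logClosed X ∧ closedUnder P X}

/-- A rule is defeated by `X` iff `bodyN r ∩ X ≠ ∅`. -/
def defeated {α : Type} (r : Rule α) (X : Set (Lit α)) : Prop := ∃ L ∈ r.bodyN, L ∈ X

/-- The Gelfond-Lifschitz reduct of `P` relative to `X`. -/
def reduct {α : Type} (P : Set (Rule α)) (X : Set (Lit α)) : Set (Rule α) :=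
  {r' | ∃ r ∈ P, ¬ defeated r X ∧ r' = Rule.mk r.head r.bodyP ∅}

/-- `X` is an answer set of `P` iff `Th (P^X) = X`. -/
def answerSet {α : Type} (P : Set (Rule α)) (X : Set (Lit α)) : Prop := Th (reduct P X) = X

/-- Generating rules of `X` from `P`. -/
def GR {α : Type} (P : Set (Rule α)) (X : Set (Lit α)) : Set (Rule α) :=
  {r | r ∈ P ∧ r.bodyP ⊆ X ∧ ¬ defeated r X}

/-- Heads of the rules occurring before position `i` in the list `l`. -/
def headsBefore {α : Type} (l : List (Rule α)) (i : ℕ) : Set (Lit α) :=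
  {L | L ∈ (l.take i).map Rule.head}

/-- The sequence of rules `l` is grounded. -/
def groundedList {α : Type} (l : List (Rule α)) : Prop :=
  ∀ (i : ℕ) (h : i < l.length),
    consistent (headsBefore l i) → (l.get ⟨i, h⟩).bodyP ⊆ headsBefore l i

/-- `l` is an enumeration of the set `S` of rules. -/
def enumerates {α : Type} (l : List (Rule α)) (S : Set (Rule α)) : Prop :=
  l.Nodup ∧ {r | r ∈ l} = S

/-- The one-step consequence operator for basic programs. -/
def TOp {α : Type} (P : Set (Rule α)) (X : Set (Lit α)) : Set (Lit α) :=
  {L | (consistent X ∧ ∃ r ∈ P, r.bodyP ⊆ X ∧ r.head = L) ∨ ¬ consistent X}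

/-- Iterated application of `TOp`, starting from `∅`. -/
def TIter {α : Type} (P : Set (Rule α)) : ℕ → Set (Lit α)
  | 0 => ∅
  | n + 1 => TOp P (TIter P n)

/-- A strict partial order whose field is contained in `P`. -/
def strictOn {γ : Type} (P : Set γ) (lt : γ → γ → Prop) : Prop :=
  (∀ a b, lt a b → a ∈ P ∧ b ∈ P) ∧ (∀ a b c, lt a b → lt b c → lt a c) ∧ (∀ a, ¬ lt a a)

/-- A total strict order on `P`. -/
def totalStrictOn {γ : Type} (P : Set γ) (ll : γ → γ → Prop) : Prop :=
  (∀ a b, ll a b → a ∈ P ∧ b ∈ P) ∧ (∀ a b c, ll a b → ll b c → ll a c) ∧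
    (∀ a, ¬ ll a a) ∧ (∀ a ∈ P, ∀ b ∈ P, a ≠ b → ll a b ∨ ll b a)

/-! ## Ordered logic programs -/

/-- Atoms of the language of an ordered logic program: regular atoms and
preference atoms `n ≺ m` over names. -/
inductive OAtom (α N : Type) : Type
  | reg : α → OAtom α N
  | pref : N → N → OAtom α N

/-- Rules of an ordered logic program. -/
abbrev ORule (α N : Type) := Rule (OAtom α N)

/-- The preference literal `(n ≺ m)`. -/
def prefLit {α N : Type} (n m : N) : Lit (OAtom α N) := Lit.pos (OAtom.pref n m)

/-- A literal over a regular atom. -/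
def regLitO {α N : Type} (L : Lit (OAtom α N)) : Prop := ∃ a, L.atom = OAtom.reg a

/-- No preference atom occurs in the rule `r`. -/
def noPref {α N : Type} (r : ORule α N) : Prop := ∀ L ∈ ruleLits r, regLitO L

/-- The dynamically induced preference `r <_X r'`, at the level of the language `𝓛`. -/
def precXO {α N : Type} (nm : ORule α N → N) (X : Set (Lit (OAtom α N)))
    (r s : ORule α N) : Prop :=
  prefLit (nm r) (nm s) ∈ X

/-- The fact `(n_r ≺ n_s) ←`. -/
def prefFactO {α N : Type} (nm : ORule α N → N) (r s : ORule α N) : ORule α N :=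
  ⟨prefLit (nm r) (nm s), ∅, ∅⟩

/-- The transitivity rule `t(r,s,t)`. -/
def tRuleO {α N : Type} (nm : ORule α N → N) (r s t : ORule α N) : ORule α N :=
  ⟨prefLit (nm r) (nm t), {prefLit (nm r) (nm s), prefLit (nm s) (nm t)}, ∅⟩

/-- The antisymmetry rule `as(r,s)`. -/
def asRuleO {α N : Type} (nm : ORule α N → N) (r s : ORule α N) : ORule α N :=
  ⟨Lit.neg (OAtom.pref (nm s) (nm r)), {prefLit (nm r) (nm s)}, ∅⟩

/-- `TA(Π)`: `Π` together with all transitivity and antisymmetry rules. -/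
def TA {α N : Type} (P : Set (ORule α N)) (nm : ORule α N → N) : Set (ORule α N) :=
  P ∪ {ru | ∃ r ∈ P, ∃ s ∈ P, ∃ t ∈ P, ru = tRuleO nm r s t}
    ∪ {ru | ∃ r ∈ P, ∃ s ∈ P, ru = asRuleO nm r s}

/-- The statically ordered program `(Π,<)`, identified with
`Π ∪ {(n_r ≺ n_{r'}) ← ∣ r < r'}`. -/
def staticProg {α N : Type} (P : Set (ORule α N)) (nm : ORule α N → N)
    (lt : ORule α N → ORule α N → Prop) : Set (ORule α N) :=
  P ∪ {ru | ∃ r ∈ P, ∃ s ∈ P, lt r s ∧ ru = prefFactO nm r s}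

/-- The heads of the generating rules occurring before position `i` in `l`. -/
def grHeadsBefore {α : Type} (l : List (Rule α)) (G : Set (Rule α)) (i : ℕ) :
    Set (Lit α) :=
  {L | ∃ j, ∃ h : j < l.length, j < i ∧ l.get ⟨j, h⟩ ∈ G ∧ (l.get ⟨j, h⟩).head = L}

/-- `X` is a `<`-preserving answer set of the statically ordered program `(P,lt)`
(Definition 1). -/
def staticPreserving {α N : Type} (P : Set (ORule α N))
    (lt : ORule α N → ORule α N → Prop) (X : Set (Lit (OAtom α N))) : Prop :=
  answerSet P X ∧ consistent X ∧
    ∃ l : List (ORule α N), enumerates l (GR P X) ∧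
      (∀ (i : ℕ) (h : i < l.length), (l.get ⟨i, h⟩).bodyP ⊆ headsBefore l i) ∧
      (∀ (i j : ℕ) (hi : i < l.length) (hj : j < l.length),
        lt (l.get ⟨i, hi⟩) (l.get ⟨j, hj⟩) → j < i) ∧
      (∀ (i : ℕ) (hi : i < l.length), ∀ r' ∈ P, r' ∉ GR P X →
        lt (l.get ⟨i, hi⟩) r' →
          ¬ r'.bodyP ⊆ X ∨ ∃ L ∈ r'.bodyN, L ∈ headsBefore l i)

/-- `X` is a `<_X`-preserving answer set of the program `P` (standing for `TA(Π)`;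
Definition 3). -/
def dynPreserving {α N : Type} (nm : ORule α N → N) (P : Set (ORule α N))
    (X : Set (Lit (OAtom α N))) : Prop :=
  answerSet P X ∧ consistent X ∧
    ∃ l : List (ORule α N), enumerates l P ∧
      (∀ (i j : ℕ) (hi : i < l.length) (hj : j < l.length),
        precXO nm X (l.get ⟨i, hi⟩) (l.get ⟨j, hj⟩) → j < i) ∧
      (∀ (i j : ℕ) (hi : i < l.length) (hj : j < l.length),
        precXO nm X (l.get ⟨i, hi⟩) (l.get ⟨j, hj⟩) →
          ∃ k, ∃ hk : k < l.length, k < i ∧ l.get ⟨k, hk⟩ ∈ GR P X ∧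
            (l.get ⟨k, hk⟩).head = prefLit (nm (l.get ⟨i, hi⟩)) (nm (l.get ⟨j, hj⟩))) ∧
      (∀ (i : ℕ) (hi : i < l.length), l.get ⟨i, hi⟩ ∈ GR P X →
        (l.get ⟨i, hi⟩).bodyP ⊆ grHeadsBefore l (GR P X) i) ∧
      (∀ (i : ℕ) (hi : i < l.length), l.get ⟨i, hi⟩ ∉ GR P X →
        ¬ (l.get ⟨i, hi⟩).bodyP ⊆ X ∨
          ∃ L ∈ (l.get ⟨i, hi⟩).bodyN, L ∈ grHeadsBefore l (GR P X) i)

/-- Occurrence of a name in a rule (inside some preference atom). -/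
def nameOccurs {α N : Type} (n : N) (r : ORule α N) : Prop :=
  ∃ L ∈ ruleLits r, ∃ m, L.atom = OAtom.pref n m ∨ L.atom = OAtom.pref m n

/-! ## The translation 𝒯 -/

/-- Atoms of the target language `𝓛⁺` of the translation `𝒯`. -/
inductive TAtom (α N : Type) : Type
  | old : OAtom α N → TAtom α N
  | ap : N → TAtom α N
  | bl : N → TAtom α N
  | ok : N → TAtom α N
  | rdy : N → N → TAtom α N

/-- Embedding of `𝓛`-literals into `𝓛⁺`. -/
def oldLit {α N : Type} (L : Lit (OAtom α N)) : Lit (TAtom α N) := L.map TAtom.old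

/-- The preference literal `(n ≺ m)` inside `𝓛⁺`. -/
def tpref {α N : Type} (n m : N) : Lit (TAtom α N) := Lit.pos (TAtom.old (OAtom.pref n m))

def apLit {α N : Type} (n : N) : Lit (TAtom α N) := Lit.pos (TAtom.ap n)
def blLit {α N : Type} (n : N) : Lit (TAtom α N) := Lit.pos (TAtom.bl n)
def okLit {α N : Type} (n : N) : Lit (TAtom α N) := Lit.pos (TAtom.ok n)
def rdyLit {α N : Type} (n m : N) : Lit (TAtom α N) := Lit.pos (TAtom.rdy n m)

/-- `a1(r) : head(r) ← ap(n_r)`. -/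
def a1Rule {α N : Type} (nm : ORule α N → N) (r : ORule α N) : Rule (TAtom α N) :=
  ⟨oldLit r.head, {apLit (nm r)}, ∅⟩

/-- `a2(r) : ap(n_r) ← ok(n_r), body(r)`. -/
def a2Rule {α N : Type} (nm : ORule α N → N) (r : ORule α N) : Rule (TAtom α N) :=
  ⟨apLit (nm r), insert (okLit (nm r)) (oldLit '' r.bodyP), oldLit '' r.bodyN⟩

/-- `b1(r,L⁺) : bl(n_r) ← ok(n_r), not L⁺`. -/
def b1Rule {α N : Type} (nm : ORule α N → N) (r : ORule α N) (L : Lit (OAtom α N)) :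
    Rule (TAtom α N) :=
  ⟨blLit (nm r), {okLit (nm r)}, {oldLit L}⟩

/-- `b2(r,L⁻) : bl(n_r) ← ok(n_r), L⁻`. -/
def b2Rule {α N : Type} (nm : ORule α N → N) (r : ORule α N) (L : Lit (OAtom α N)) :
    Rule (TAtom α N) :=
  ⟨blLit (nm r), {okLit (nm r), oldLit L}, ∅⟩

/-- `c1(r) : ok(n_r) ← rdy(n_r,n_{r_1}), …, rdy(n_r,n_{r_k})`. -/
def c1Rule {α N : Type} (P : Set (ORule α N)) (nm : ORule α N → N) (r : ORule α N) :
    Rule (TAtom α N) :=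
  ⟨okLit (nm r), {L | ∃ s ∈ P, L = rdyLit (nm r) (nm s)}, ∅⟩

/-- `c2(r,s) : rdy(n_r,n_s) ← not (n_r ≺ n_s)`. -/
def c2Rule {α N : Type} (nm : ORule α N → N) (r s : ORule α N) : Rule (TAtom α N) :=
  ⟨rdyLit (nm r) (nm s), ∅, {tpref (nm r) (nm s)}⟩

/-- `c3(r,s) : rdy(n_r,n_s) ← (n_r ≺ n_s), ap(n_s)`. -/
def c3Rule {α N : Type} (nm : ORule α N → N) (r s : ORule α N) : Rule (TAtom α N) :=
  ⟨rdyLit (nm r) (nm s), {tpref (nm r) (nm s), apLit (nm s)}, ∅⟩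

/-- `c4(r,s) : rdy(n_r,n_s) ← (n_r ≺ n_s), bl(n_s)`. -/
def c4Rule {α N : Type} (nm : ORule α N → N) (r s : ORule α N) : Rule (TAtom α N) :=
  ⟨rdyLit (nm r) (nm s), {tpref (nm r) (nm s), blLit (nm s)}, ∅⟩

/-- `t(r,s,t) : (n_r ≺ n_t) ← (n_r ≺ n_s), (n_s ≺ n_t)` inside `𝓛⁺`. -/
def tRuleT {α N : Type} (nm : ORule α N → N) (r s t : ORule α N) : Rule (TAtom α N) :=
  ⟨tpref (nm r) (nm t), {tpref (nm r) (nm s), tpref (nm s) (nm t)}, ∅⟩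

/-- `as(r,s) : ¬(n_s ≺ n_r) ← (n_r ≺ n_s)` inside `𝓛⁺`. -/
def asRuleT {α N : Type} (nm : ORule α N → N) (r s : ORule α N) : Rule (TAtom α N) :=
  ⟨Lit.neg (TAtom.old (OAtom.pref (nm s) (nm r))), {tpref (nm r) (nm s)}, ∅⟩

/-- The set of rules `τ(r)` of Definition 2. -/
def tau {α N : Type} (P : Set (ORule α N)) (nm : ORule α N → N) (r : ORule α N) :
    Set (Rule (TAtom α N)) :=
  {a1Rule nm r, a2Rule nm r, c1Rule P nm r}
    ∪ {ru | ∃ L ∈ r.bodyP, ru = b1Rule nm r L}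
    ∪ {ru | ∃ L ∈ r.bodyN, ru = b2Rule nm r L}
    ∪ {ru | ∃ s ∈ P, ru = c2Rule nm r s ∨ ru = c3Rule nm r s ∨ ru = c4Rule nm r s}
    ∪ {ru | ∃ s ∈ P, ∃ t ∈ P, ru = tRuleT nm r s t}
    ∪ {ru | ∃ s ∈ P, ru = asRuleT nm r s}

/-- The translation `𝒯(Π) = ⋃_{r ∈ Π} τ(r)`. -/
def TTrans {α N : Type} (P : Set (ORule α N)) (nm : ORule α N → N) :
    Set (Rule (TAtom α N)) :=
  {ru | ∃ r ∈ P, ru ∈ tau P nm r}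

/-- `𝒯(Π,<)` for a statically ordered program. -/
def TStatic {α N : Type} (P : Set (ORule α N)) (nm : ORule α N → N)
    (lt : ORule α N → ORule α N → Prop) : Set (Rule (TAtom α N)) :=
  TTrans (staticProg P nm lt) nm

/-- The dynamically induced preference `r <_X r'` read off from an answer set of
the translated program. -/
def precX {α N : Type} (nm : ORule α N → N) (X : Set (Lit (TAtom α N)))
    (r s : ORule α N) : Prop :=
  tpref (nm r) (nm s) ∈ X

/-- The literals of `𝓛⁺` over regular atoms (the set `𝓛_𝒜`). -/
def regLitsT {α N : Type} : Set (Lit (TAtom α N)) :=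
  {L | ∃ a, L.atom = TAtom.old (OAtom.reg a)}

/-- The literals of `𝓛⁺` belonging to the original language `𝓛`. -/
def oldLitsT {α N : Type} : Set (Lit (TAtom α N)) := Set.range oldLit

/-- A rule of `𝒯(Π)` that is an "image" of `r ∈ Π`:
`a2(r)`, or `b1(r,L)`/`b2(r,L)` for some body literal `L` of `r`. -/
def imgRule {α N : Type} (nm : ORule α N → N) (r : ORule α N)
    (ru : Rule (TAtom α N)) : Prop :=
  ru = a2Rule nm r ∨ (∃ L ∈ r.bodyP, ru = b1Rule nm r L) ∨
    (∃ L ∈ r.bodyN, ru = b2Rule nm r L)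

/-! ## The translation 𝒰 (Brewka–Eiter encoding) -/

/-- Atoms of the target language `𝓛°` of the translation `𝒰`. -/
inductive UAtom (α N : Type) : Type
  | old : OAtom α N → UAtom α N
  | pr : OAtom α N → UAtom α N
  | ap : N → UAtom α N
  | bl : N → UAtom α N
  | ok : N → UAtom α N
  | rdy : N → N → UAtom α N
  | de : N → UAtom α N

def uold {α N : Type} (L : Lit (OAtom α N)) : Lit (UAtom α N) := L.map UAtom.old
def uprimed {α N : Type} (L : Lit (OAtom α N)) : Lit (UAtom α N) := L.map UAtom.pr
def upref {α N : Type} (n m : N) : Lit (UAtom α N) := Lit.pos (UAtom.old (OAtom.pref n m))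
def uapLit {α N : Type} (n : N) : Lit (UAtom α N) := Lit.pos (UAtom.ap n)
def ublLit {α N : Type} (n : N) : Lit (UAtom α N) := Lit.pos (UAtom.bl n)
def uokLit {α N : Type} (n : N) : Lit (UAtom α N) := Lit.pos (UAtom.ok n)
def urdyLit {α N : Type} (n m : N) : Lit (UAtom α N) := Lit.pos (UAtom.rdy n m)
def udeLit {α N : Type} (n : N) : Lit (UAtom α N) := Lit.pos (UAtom.de n)

/-- `a1(r) : head(r') ← ap(n_r)`. -/
def ua1 {α N : Type} (nm : ORule α N → N) (r : ORule α N) : Rule (UAtom α N) :=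
  ⟨uprimed r.head, {uapLit (nm r)}, ∅⟩

/-- `a2(r) : ap(n_r) ← ok(n_r), body(r), not body⁻(r')`. -/
def ua2 {α N : Type} (nm : ORule α N → N) (r : ORule α N) : Rule (UAtom α N) :=
  ⟨uapLit (nm r), insert (uokLit (nm r)) (uold '' r.bodyP),
    uold '' r.bodyN ∪ uprimed '' r.bodyN⟩

/-- `b1(r,L) : bl(n_r) ← ok(n_r), not L, not L'`. -/
def ub1 {α N : Type} (nm : ORule α N → N) (r : ORule α N) (L : Lit (OAtom α N)) :
    Rule (UAtom α N) :=
  ⟨ublLit (nm r), {uokLit (nm r)}, {uold L, uprimed L}⟩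

/-- `b2(r,K) : bl(n_r) ← ok(n_r), K, K'`. -/
def ub2 {α N : Type} (nm : ORule α N → N) (r : ORule α N) (K : Lit (OAtom α N)) :
    Rule (UAtom α N) :=
  ⟨ublLit (nm r), {uokLit (nm r), uold K, uprimed K}, ∅⟩

/-- `c1(r) : ok(n_r) ← rdy(n_r,n_{r_1}), …, rdy(n_r,n_{r_k})`. -/
def uc1 {α N : Type} (P : Set (ORule α N)) (nm : ORule α N → N) (r : ORule α N) :
    Rule (UAtom α N) :=
  ⟨uokLit (nm r), {L | ∃ s ∈ P, L = urdyLit (nm r) (nm s)}, ∅⟩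

/-- `c2(r,s) : rdy(n_r,n_s) ← not (n_r ≺ n_s)`. -/
def uc2 {α N : Type} (nm : ORule α N → N) (r s : ORule α N) : Rule (UAtom α N) :=
  ⟨urdyLit (nm r) (nm s), ∅, {upref (nm r) (nm s)}⟩

/-- `c3(r,s) : rdy(n_r,n_s) ← (n_r ≺ n_s), ap(n_s)`. -/
def uc3 {α N : Type} (nm : ORule α N → N) (r s : ORule α N) : Rule (UAtom α N) :=
  ⟨urdyLit (nm r) (nm s), {upref (nm r) (nm s), uapLit (nm s)}, ∅⟩

/-- `c4(r,s) : rdy(n_r,n_s) ← (n_r ≺ n_s), bl(n_s)`. -/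
def uc4 {α N : Type} (nm : ORule α N → N) (r s : ORule α N) : Rule (UAtom α N) :=
  ⟨urdyLit (nm r) (nm s), {upref (nm r) (nm s), ublLit (nm s)}, ∅⟩

/-- `c5(r,s,J) : rdy(n_r,n_s) ← head(s), J`. -/
def uc5 {α N : Type} (nm : ORule α N → N) (r s : ORule α N) (J : Lit (OAtom α N)) :
    Rule (UAtom α N) :=
  ⟨urdyLit (nm r) (nm s), {uold s.head, uold J}, ∅⟩

/-- The constraint `de(r) : ← not ok(n_r)`, rendered as
`p_r ← not ok(n_r), not p_r` for the fresh atom `p_r = de(n_r)`. -/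
def ude {α N : Type} (nm : ORule α N → N) (r : ORule α N) : Rule (UAtom α N) :=
  ⟨udeLit (nm r), ∅, {uokLit (nm r), udeLit (nm r)}⟩

/-- Transitivity rule inside `𝓛°`. -/
def utr {α N : Type} (nm : ORule α N → N) (r s t : ORule α N) : Rule (UAtom α N) :=
  ⟨upref (nm r) (nm t), {upref (nm r) (nm s), upref (nm s) (nm t)}, ∅⟩

/-- Antisymmetry rule inside `𝓛°`. -/
def uas {α N : Type} (nm : ORule α N → N) (r s : ORule α N) : Rule (UAtom α N) :=
  ⟨Lit.neg (UAtom.old (OAtom.pref (nm s) (nm r))), {upref (nm r) (nm s)}, ∅⟩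

/-- The set of rules `τ(r)` of Definition 8. -/
def utau {α N : Type} (P : Set (ORule α N)) (nm : ORule α N → N) (r : ORule α N) :
    Set (Rule (UAtom α N)) :=
  {ua1 nm r, ua2 nm r, uc1 P nm r, ude nm r}
    ∪ {ru | ∃ L ∈ r.bodyP, ru = ub1 nm r L}
    ∪ {ru | ∃ K ∈ r.bodyN, ru = ub2 nm r K}
    ∪ {ru | ∃ s ∈ P, ru = uc2 nm r s ∨ ru = uc3 nm r s ∨ ru = uc4 nm r s}
    ∪ {ru | ∃ s ∈ P, ∃ J ∈ s.bodyN, ru = uc5 nm r s J}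
    ∪ {ru | ∃ s ∈ P, ∃ t ∈ P, ru = utr nm r s t}
    ∪ {ru | ∃ s ∈ P, ru = uas nm r s}

/-- The translation `𝒰(Π) = Π ∪ ⋃_{r ∈ Π} τ(r)`. -/
def UTrans {α N : Type} (P : Set (ORule α N)) (nm : ORule α N → N) :
    Set (Rule (UAtom α N)) :=
  (Rule.map UAtom.old) '' P ∪ {ru | ∃ r ∈ P, ru ∈ utau P nm r}

/-- The fact `(n_r ≺ n_s) ←` inside `𝓛°`. -/
def uPrefFact {α N : Type} (nm : ORule α N → N) (r s : ORule α N) : Rule (UAtom α N) :=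
  ⟨upref (nm r) (nm s), ∅, ∅⟩

/-- The literals of `𝓛°` over regular atoms (the set `𝓛_𝒜`). -/
def regLitsU {α N : Type} : Set (Lit (UAtom α N)) :=
  {L | ∃ a, L.atom = UAtom.old (OAtom.reg a)}

/-! ## Brewka–Eiter preferred answer sets -/

/-- `reductBE r = head(r) ← not body⁻(r)`. -/
def reductBE {γ : Type} (r : Rule γ) : Rule γ := ⟨r.head, ∅, r.bodyN⟩

/-- The sequence `X_i` of Definition 5 (for the enumeration `l` and the set `X`). -/
def CSeq {γ : Type} (l : List (Rule γ)) (X : Set (Lit γ)) : ℕ → Set (Lit γ)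
  | 0 => ∅
  | i + 1 =>
    CSeq l X i ∪
      {L | ∃ h : i < l.length,
        ¬ defeated (l.get ⟨i, h⟩) (CSeq l X i) ∧
        ¬ ((l.get ⟨i, h⟩).head ∈ X ∧ defeated (l.get ⟨i, h⟩) X) ∧
        L = (l.get ⟨i, h⟩).head}

/-- The operator `C` of Definition 5. -/
def COp {γ : Type} (l : List (Rule γ)) (X : Set (Lit γ)) : Set (Lit γ) :=
  logClosure (⋃ i, CSeq l X i)

/-- `l` is the enumeration of `P` according to the total order `ll`
(most preferred rule first). -/
def descList {γ : Type} (l : List (Rule γ)) (P : Set (Rule γ))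
    (ll : Rule γ → Rule γ → Prop) : Prop :=
  enumerates l P ∧
    ∀ (i j : ℕ) (hi : i < l.length) (hj : j < l.length), i < j →
      ll (l.get ⟨j, hj⟩) (l.get ⟨i, hi⟩)

/-- `X` is the BE-preferred answer set of the fully ordered prerequisite-free
program `(P,ll)`. -/
def BEPrefPF {γ : Type} (P : Set (Rule γ)) (ll : Rule γ → Rule γ → Prop)
    (X : Set (Lit γ)) : Prop :=
  ∃ l, descList l P ll ∧ COp l X = X

/-- The program `Π_X` of Definition 7. -/
def PiX {γ : Type} (P : Set (Rule γ)) (X : Set (Lit γ)) : Set (Rule γ) :=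
  {r' | ∃ r ∈ P, r.bodyP ⊆ X ∧ r' = reductBE r}

/-- `r` is the `ll`-maximal rule of `P` whose BE-reduct is `a`. -/
def beMax {γ : Type} (P : Set (Rule γ)) (ll : Rule γ → Rule γ → Prop)
    (a r : Rule γ) : Prop :=
  r ∈ P ∧ reductBE r = a ∧ ∀ s ∈ P, reductBE s = a → s = r ∨ ll s r

/-- The inherited order `ll_X` of Definition 7. -/
def llX {γ : Type} (P : Set (Rule γ)) (ll : Rule γ → Rule γ → Prop)
    (a b : Rule γ) : Prop :=
  ∃ r1 r2, beMax P ll a r1 ∧ beMax P ll b r2 ∧ ll r1 r2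

/-- `X` is a BE-preferred answer set of the fully ordered program `(P,ll)`. -/
def BEPrefFull {γ : Type} (P : Set (Rule γ)) (ll : Rule γ → Rule γ → Prop)
    (X : Set (Lit γ)) : Prop :=
  answerSet P X ∧ BEPrefPF (PiX P X) (llX P ll) X

/-- `X` is a BE-preferred answer set of the statically ordered program `(P,lt)`. -/
def BEPreferred {γ : Type} (P : Set (Rule γ)) (lt : Rule γ → Rule γ → Prop)
    (X : Set (Lit γ)) : Prop :=
  ∃ ll, totalStrictOn P ll ∧ (∀ a b, lt a b → ll a b) ∧ BEPrefFull P ll X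


theorem oldLit_injective {α N : Type} :
    Function.Injective (oldLit : Lit (OAtom α N) → Lit (TAtom α N)) := by
  rintro (a | a) (b | b) h <;> simp_all [oldLit, Lit.map]

theorem closedUnder_reduct_iff {γ : Type} {P : Set (Rule γ)} {X Z : Set (Lit γ)} :
    closedUnder (reduct P X) Z ↔
      ∀ r ∈ P, (∀ L ∈ r.bodyN, L ∉ X) → r.bodyP ⊆ Z → r.head ∈ Z := by
  constructor
  · intro h r hr hn hp
    exact h ⟨r.head, r.bodyP, ∅⟩ ⟨r, hr, fun ⟨L, h1, h2⟩ => hn L h1 h2, rfl⟩ hp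
  · rintro h _ ⟨r, hr, hd, rfl⟩ hp
    exact h r hr (fun L h1 h2 => hd ⟨L, h1, h2⟩) hp

theorem logClosed_Th {γ : Type} (P : Set (Rule γ)) : logClosed (Th P) := by
  by_cases h : ∃ Z, (logClosed Z ∧ closedUnder P Z) ∧ consistent Z
  · obtain ⟨Z, hZ, hc⟩ := h
    left
    rintro ⟨a, hp, hn⟩
    exact hc ⟨a, hp Z hZ, hn Z hZ⟩
  · right
    refine Set.eq_univ_of_forall fun L Z hZ => ?_
    rcases hZ.1 with hc | rfl
    · exact absurd ⟨Z, hZ, hc⟩ h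
    · trivial

theorem answerSet.logClosed {γ : Type} {P : Set (Rule γ)} {Y : Set (Lit γ)}
    (hY : answerSet P Y) : logClosed Y := by
  have := logClosed_Th (reduct P Y)
  rwa [show Th (reduct P Y) = Y from hY] at this

theorem answerSet.head_mem {γ : Type} {P : Set (Rule γ)} {Y : Set (Lit γ)}
    (hY : answerSet P Y) {r : Rule γ} (hr : r ∈ P) (hp : r.bodyP ⊆ Y)
    (hn : ∀ L ∈ r.bodyN, L ∉ Y) : r.head ∈ Y := by
  have hY' : Th (reduct P Y) = Y := hY
  rw [← hY']
  intro Z hZ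
  refine closedUnder_reduct_iff.1 hZ.2 r hr hn fun L hL => ?_
  have := hp hL
  rw [← hY'] at this
  exact this Z hZ

/-- Induction over the derivation of the literals of a consistent answer set. -/
theorem answerSet.induction {γ : Type} {P : Set (Rule γ)} {Y : Set (Lit γ)}
    (hY : answerSet P Y) (hc : consistent Y) {p : Lit γ → Prop}
    (hp : ∀ r ∈ P, (∀ L ∈ r.bodyN, L ∉ Y) → (∀ L ∈ r.bodyP, L ∈ Y ∧ p L) → p r.head)
    {L : Lit γ} (hL : L ∈ Y) : p L := by
  have hY' : Th (reduct P Y) = Y := hY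
  rw [← hY'] at hL
  refine (hL {L | L ∈ Y ∧ p L} ⟨.inl fun ⟨a, h1, h2⟩ => hc ⟨a, h1.1, h2.1⟩,
    closedUnder_reduct_iff.2 fun r hr hn hb => ?_⟩).2
  exact ⟨hY.head_mem hr (fun L h => (hb h).1) hn, hp r hr hn hb⟩

section Translation

variable {α N : Type} {Q : Set (ORule α N)} {nm : ORule α N → N} {Y : Set (Lit (TAtom α N))}

/-- Every rule of a translated program is one of the listed ones. -/
theorem TTrans_cases {ru : Rule (TAtom α N)} (h : ru ∈ TTrans Q nm) :
    ∃ r ∈ Q, ru = a1Rule nm r ∨ ru = a2Rule nm r ∨ ru = c1Rule Q nm r ∨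
      (∃ L ∈ r.bodyP, ru = b1Rule nm r L) ∨ (∃ L ∈ r.bodyN, ru = b2Rule nm r L) ∨
      (∃ s ∈ Q, ru = c2Rule nm r s) ∨ (∃ s ∈ Q, ru = c3Rule nm r s) ∨
      (∃ s ∈ Q, ru = c4Rule nm r s) ∨ (∃ s ∈ Q, ∃ t ∈ Q, ru = tRuleT nm r s t) ∨
      (∃ s ∈ Q, ru = asRuleT nm r s) := by
  obtain ⟨r, hr, ((((((h | h | h) | h) | h) | ⟨s, hs, h | h | h⟩) | h) | h)⟩ := h <;>
    refine ⟨r, hr, ?_⟩ <;> grind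

theorem consistent_of_answerSet_TTrans (hY : answerSet (TTrans Q nm) Y) : consistent Y := by
  rcases hY.logClosed with hc | rfl
  · exact hc
  · have hY' : Th (reduct (TTrans Q nm) Set.univ) = Set.univ := hY
    rintro ⟨a, ha, -⟩
    rw [← hY'] at ha
    refine ha ∅ ⟨.inl (by rintro ⟨_, h, -⟩; exact h),
      closedUnder_reduct_iff.2 fun ru hru hn hb => False.elim ?_⟩
    obtain ⟨r, hr, h⟩ := TTrans_cases hru
    rcases h with rfl | rfl | rfl | ⟨L, hL, rfl⟩ | ⟨L, hL, rfl⟩ | ⟨s, hs, rfl⟩ | ⟨s, hs, rfl⟩ |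
      ⟨s, hs, rfl⟩ | ⟨s, hs, t, ht, rfl⟩ | ⟨s, hs, rfl⟩
    · exact hb (Set.mem_singleton _)
    · exact hb (Set.mem_insert _ _)
    · exact hb (a := rdyLit (nm r) (nm r)) ⟨r, hr, rfl⟩
    · exact hn _ rfl trivial
    · exact hb (Set.mem_insert _ _)
    · exact hn _ rfl trivial
    · exact hb (Set.mem_insert _ _)
    · exact hb (Set.mem_insert _ _)
    · exact hb (Set.mem_insert _ _)
    · exact hb (Set.mem_singleton _)

theorem ap_or_bl_mem (hY : answerSet (TTrans Q nm) Y) {r : ORule α N} (hr : r ∈ Q)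
    (hok : okLit (nm r) ∈ Y) : apLit (nm r) ∈ Y ∨ blLit (nm r) ∈ Y := by
  by_cases hp : ∃ L ∈ r.bodyP, oldLit L ∉ Y
  · obtain ⟨L, hL, hLY⟩ := hp
    right
    refine hY.head_mem (r := b1Rule nm r L) ⟨r, hr, by simp only [tau, Set.mem_union]; grind⟩ ?_ ?_
    · rintro _ rfl; exact hok
    · rintro _ rfl; exact hLY
  by_cases hn : ∃ L ∈ r.bodyN, oldLit L ∈ Y
  · obtain ⟨L, hL, hLY⟩ := hn
    right
    refine hY.head_mem (r := b2Rule nm r L) ⟨r, hr, by simp only [tau, Set.mem_union]; grind⟩ ?_ ?_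
    · rintro _ (rfl | rfl)
      exacts [hok, hLY]
    · rintro _ ⟨⟩
  · left
    push Not at hp hn
    refine hY.head_mem (r := a2Rule nm r) ⟨r, hr, by simp [tau]⟩ ?_ ?_
    · rintro _ (rfl | ⟨L, hL, rfl⟩)
      exacts [hok, hp L hL]
    · rintro _ ⟨L, hL, rfl⟩
      exact hn L hL

theorem rdy_mem (hY : answerSet (TTrans Q nm) Y) {r s : ORule α N} (hr : r ∈ Q) (hs : s ∈ Q)
    (h : tpref (nm r) (nm s) ∈ Y → okLit (nm s) ∈ Y) : rdyLit (nm r) (nm s) ∈ Y := by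
  by_cases hpr : tpref (nm r) (nm s) ∈ Y
  · rcases ap_or_bl_mem hY hs (h hpr) with ha | hb
    · refine hY.head_mem (r := c3Rule nm r s)
        ⟨r, hr, by simp only [tau, Set.mem_union]; grind⟩ ?_ ?_
      · rintro _ (rfl | rfl)
        exacts [hpr, ha]
      · rintro _ ⟨⟩
    · refine hY.head_mem (r := c4Rule nm r s)
        ⟨r, hr, by simp only [tau, Set.mem_union]; grind⟩ ?_ ?_
      · rintro _ (rfl | rfl)
        exacts [hpr, hb]
      · rintro _ ⟨⟩
  · refine hY.head_mem (r := c2Rule nm r s)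
      ⟨r, hr, by simp only [tau, Set.mem_union]; grind⟩ ?_ ?_
    · rintro _ ⟨⟩
    · rintro _ rfl; exact hpr

theorem ok_mem (hY : answerSet (TTrans Q nm) Y) {r : ORule α N} (hr : r ∈ Q)
    (h : ∀ s ∈ Q, tpref (nm r) (nm s) ∈ Y → okLit (nm s) ∈ Y) : okLit (nm r) ∈ Y := by
  refine hY.head_mem (r := c1Rule Q nm r) ⟨r, hr, by simp [tau]⟩ ?_ ?_
  · rintro _ ⟨s, hs, rfl⟩
    exact rdy_mem hY hr hs (h s hs)
  · rintro _ ⟨⟩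

theorem head_mem_of_ok (hY : answerSet (TTrans Q nm) Y) {r : ORule α N} (hr : r ∈ Q)
    (hok : okLit (nm r) ∈ Y) (hp : ∀ L ∈ r.bodyP, oldLit L ∈ Y)
    (hn : ∀ L ∈ r.bodyN, oldLit L ∉ Y) : oldLit r.head ∈ Y := by
  refine hY.head_mem (r := a1Rule nm r) ⟨r, hr, by simp [tau]⟩ ?_ (by rintro _ ⟨⟩)
  rintro _ rfl
  refine hY.head_mem (r := a2Rule nm r) ⟨r, hr, by simp [tau]⟩ ?_ ?_
  · rintro _ (rfl | ⟨L, hL, rfl⟩)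
    exacts [hok, hp L hL]
  · rintro _ ⟨L, hL, rfl⟩
    exact hn L hL

end Translation

section Static

variable {α N : Type} {P : Set (ORule α N)} {nm : ORule α N → N}
  {lt : ORule α N → ORule α N → Prop} {Y : Set (Lit (TAtom α N))}

theorem not_regLitO_prefLit (n m : N) : ¬ regLitO (prefLit n m : Lit (OAtom α N)) := by
  rintro ⟨a, ⟨⟩⟩

/-- Every preference derived in an answer set of `𝒯(Π,<)` stems from `<`. -/
theorem lt_of_tpref_mem (hreg : ∀ r ∈ P, noPref r)
    (htrans : ∀ a b c, lt a b → lt b c → lt a c)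
    (hinj : Set.InjOn nm (staticProg P nm lt))
    (hY : answerSet (TStatic P nm lt) Y) {n m : N} (h : tpref n m ∈ Y) :
    ∃ r ∈ P, ∃ s ∈ P, lt r s ∧ n = nm r ∧ m = nm s := by
  have key : ∀ L ∈ Y, ∀ n m, L = tpref n m →
      ∃ r ∈ P, ∃ s ∈ P, lt r s ∧ n = nm r ∧ m = nm s := by
    intro L hL
    refine hY.induction (consistent_of_answerSet_TTrans hY) (p := fun L => ∀ n m, L = tpref n m →
      ∃ r ∈ P, ∃ s ∈ P, lt r s ∧ n = nm r ∧ m = nm s) ?_ hL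
    rintro ru hru - hb n m he
    obtain ⟨r, hr, h⟩ := TTrans_cases hru
    rcases h with rfl | rfl | rfl | ⟨L, hL, rfl⟩ | ⟨L, hL, rfl⟩ | ⟨s, hs, rfl⟩ | ⟨s, hs, rfl⟩ |
      ⟨s, hs, rfl⟩ | ⟨s, hs, t, ht, rfl⟩ | ⟨s, hs, rfl⟩
    · have hhead : r.head = prefLit n m := oldLit_injective he
      rcases hr with hr | ⟨a, ha, b, hbP, hab, rfl⟩
      · have := hreg r hr r.head (.inl rfl)
        rw [hhead] at this
        exact absurd this (not_regLitO_prefLit n m)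
      · cases hhead
        exact ⟨a, ha, b, hbP, hab, rfl, rfl⟩
    · cases he
    · cases he
    · cases he
    · cases he
    · cases he
    · cases he
    · cases he
    · obtain ⟨a, ha, b, hb', hab, h1, h2⟩ := (hb _ (.inl rfl)).2 _ _ rfl
      obtain ⟨c, hc, d, hd, hcd, h3, h4⟩ := (hb _ (.inr rfl)).2 _ _ rfl
      obtain rfl : b = c := hinj (.inl hb') (.inl hc) (h2.symm.trans h3)
      cases he
      exact ⟨a, ha, d, hd, htrans _ _ _ hab hcd, h1, h4⟩
    · cases he
  exact key _ h n m rfl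

theorem ok_mem_of_answerSet_TStatic (hfin : P.Finite) (hreg : ∀ r ∈ P, noPref r)
    (hlt : strictOn P lt) (hinj : Set.InjOn nm (staticProg P nm lt))
    (hY : answerSet (TStatic P nm lt) Y) {r : ORule α N} (hr : r ∈ P) :
    okLit (nm r) ∈ Y := by
  have : IsStrictOrder (ORule α N) (Function.swap lt) :=
    { irrefl := hlt.2.2
      trans := fun a b c hab hbc => hlt.2.1 c b a hbc hab }
  have hwf : P.WellFoundedOn (Function.swap lt) := hfin.wellFoundedOn
  refine hwf.induction (P := fun r => okLit (nm r) ∈ Y) hr fun r hr ih => ?_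
  refine ok_mem hY (.inl hr) fun s hs hpr => ?_
  obtain ⟨a, ha, b, hb, hab, h1, h2⟩ := lt_of_tpref_mem hreg hlt.2.1 hinj hY hpr
  obtain rfl := hinj (.inl hr) (.inl ha) h1
  obtain rfl := hinj hs (.inl hb) h2
  exact ih s hb hab

/-- The regular part of an answer set of `𝒯(Π,<)` is contained in every set of literals
closed under the corresponding reduct of `Π`. -/
theorem mem_of_closedUnder (hinj : Set.InjOn nm (staticProg P nm lt))
    (hY : answerSet (TStatic P nm lt) Y) (hreg : ∀ r ∈ P, noPref r)
    {X Z : Set (Lit (OAtom α N))} (hXY : ∀ L ∈ X, oldLit L ∈ Y)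
    (hZ : closedUnder (reduct P X) Z)
    {L : Lit (OAtom α N)} (hL : oldLit L ∈ Y) (hr : regLitO L) : L ∈ Z := by
  refine (hY.induction (consistent_of_answerSet_TTrans hY)
    (p := fun K => (∀ L, K = oldLit L → regLitO L → L ∈ Z) ∧
      ∀ r ∈ P, K = apLit (nm r) → r.head ∈ Z) ?_ hL).1 L rfl hr
  clear hL hr L
  intro ru hru hn hb
  obtain ⟨r, hr, h⟩ := TTrans_cases hru
  rcases h with rfl | rfl | rfl | ⟨L, hL, rfl⟩ | ⟨L, hL, rfl⟩ | ⟨s, hs, rfl⟩ | ⟨s, hs, rfl⟩ |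
    ⟨s, hs, rfl⟩ | ⟨s, hs, t, ht, rfl⟩ | ⟨s, hs, rfl⟩
  · refine ⟨fun L hL hLr => ?_, fun s hs he => ?_⟩
    · obtain rfl : r.head = L := oldLit_injective hL
      rcases hr with hr | ⟨a, ha, b, hb, hab, rfl⟩
      · exact (hb _ rfl).2.2 r hr rfl
      · exact absurd hLr (not_regLitO_prefLit _ _)
    · simp only [a1Rule] at he
      rcases hh : r.head with a | a <;> rw [hh] at he <;> cases he
  · refine ⟨fun L hL hLr => ?_, fun s hs he => ?_⟩
    · rcases L with a | a <;> cases hL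
    · have hnm : nm r = nm s := by simpa [a2Rule, apLit] using he
      obtain rfl := hinj hr (.inl hs) hnm
      refine closedUnder_reduct_iff.1 hZ r hs (fun L h1 h2 => hn _ ⟨L, h1, rfl⟩ (hXY L h2))
        fun L hL => ?_
      exact (hb _ (.inr ⟨L, hL, rfl⟩)).2.1 L rfl (hreg r hs L (.inr (.inl hL)))
  all_goals
    refine ⟨fun L hL hLr => ?_, fun s hs he => by cases he⟩
    rcases L with a | a <;> cases hL
  all_goals
    obtain ⟨_, ⟨⟩⟩ := hLr

end Static

theorem stmt9 {α N : Type} (P : Set (ORule α N)) (nm : ORule α N → N)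
    (lt : ORule α N → ORule α N → Prop)
    (hfin : P.Finite) (hreg : ∀ r ∈ P, noPref r) (hlt : strictOn P lt)
    (hnm : Set.BijOn nm (staticProg P nm lt) Set.univ)
    (X : Set (Lit (OAtom α N)))
    (h : ∃ Y, answerSet (TStatic P nm lt) Y ∧
      Lit.map TAtom.old '' X = Y ∩ regLitsT) :
    answerSet P X := by
  obtain ⟨Y, hY, hXY⟩ := h
  have hinj := hnm.injOn
  have hX : ∀ L, L ∈ X ↔ oldLit L ∈ Y ∧ regLitO L := by
    intro L
    have hmem : L ∈ X ↔ oldLit L ∈ Y ∩ regLitsT := by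
      rw [← hXY]
      exact (oldLit_injective.mem_set_image (s := X) (a := L)).symm
    rw [hmem]
    refine and_congr Iff.rfl ?_
    rcases L with a | a <;> simp [regLitsT, regLitO, oldLit, Lit.map, Lit.atom]
  have hXcons : consistent X := by
    rintro ⟨a, h1, h2⟩
    exact consistent_of_answerSet_TTrans hY ⟨TAtom.old a, ((hX _).1 h1).1, ((hX _).1 h2).1⟩
  apply Set.Subset.antisymm
  · refine Set.sInter_subset_of_mem ⟨.inl hXcons,
      closedUnder_reduct_iff.2 fun r hr hn hb => ?_⟩
    refine (hX _).2 ⟨head_mem_of_ok hY (.inl hr)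
      (ok_mem_of_answerSet_TStatic hfin hreg hlt hinj hY hr) (fun L hL => ((hX L).1 (hb hL)).1)
      fun L hL hLY => ?_, hreg r hr _ (.inl rfl)⟩
    exact hn L hL ((hX L).2 ⟨hLY, hreg r hr L (.inr (.inr hL))⟩)
  · intro L hL Z hZ
    exact mem_of_closedUnder hinj hY hreg (fun K hK => ((hX K).1 hK).1) hZ.2
      ((hX L).1 hL).1 ((hX L).1 hL).2

end ASP
end

section
/- (Principle II-S.) Let (Π,<) be a statically ordered logic program and X a <-preserving answer set of Π. Let r be a rule with body⁺(r) ⊄ X, and let (Π ∪ {r}, <') be a statically ordered logic program such that < = <' ∩ (Π × Π). Then X is a <'-preserving answer set of Π ∪ {r}. -/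
set_option autoImplicit false

namespace ASP

/-- `Th P` is closed under `P`. -/
theorem closedUnder_Th {α : Type} (P : Set (Rule α)) : closedUnder P (Th P) := by
  intro r hr hb Y hY
  exact hY.2 r hr fun L hL => hb hL Y hY

/-- `Th` is monotone in the program. -/
theorem Th_mono {α : Type} {P Q : Set (Rule α)} (h : P ⊆ Q) : Th P ⊆ Th Q :=
  fun _ hL Y hY => hL Y ⟨hY.1, fun r hr => hY.2 r (h hr)⟩

/-- Adding a rule whose prerequisites are not contained in a consistent answer set `X`
leaves `X` an answer set. -/
theorem answerSet_insert {α : Type} {P : Set (Rule α)} {X : Set (Lit α)} {r : Rule α}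
    (hX : answerSet P X) (hcons : consistent X) (hr : ¬ r.bodyP ⊆ X) :
    answerSet (insert r P) X := by
  have hclosed : closedUnder (reduct P X) X := by
    have h := closedUnder_Th (reduct P X)
    rwa [show Th (reduct P X) = X from hX] at h
  have hmono : reduct P X ⊆ reduct (insert r P) X := by
    rintro _ ⟨s, hs, hd, rfl⟩
    exact ⟨s, Set.mem_insert_of_mem r hs, hd, rfl⟩
  apply Set.Subset.antisymm
  · refine Set.sInter_subset_of_mem ⟨Or.inl hcons, ?_⟩
    rintro _ ⟨s, rfl | hs, hd, rfl⟩ hb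
    · exact absurd hb hr
    · exact hclosed _ ⟨s, hs, hd, rfl⟩ hb
  · have h := Th_mono hmono
    rwa [show Th (reduct P X) = X from hX] at h

/-- A rule whose prerequisites are not contained in `X` is not generating. -/
theorem GR_insert {α : Type} {P : Set (Rule α)} {X : Set (Lit α)} {r : Rule α}
    (hr : ¬ r.bodyP ⊆ X) : GR (insert r P) X = GR P X := by
  ext s
  constructor
  · rintro ⟨rfl | hs, hb, hd⟩
    · exact absurd hb hr
    · exact ⟨hs, hb, hd⟩
  · rintro ⟨hs, hb, hd⟩
    exact ⟨Set.mem_insert_of_mem r hs, hb, hd⟩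

theorem stmt15 {α N : Type} (P : Set (ORule α N))
    (lt lt' : ORule α N → ORule α N → Prop) (r : ORule α N)
    (hfin : P.Finite) (hreg : ∀ s ∈ P, noPref s) (hregr : noPref r)
    (hlt : strictOn P lt) (hlt' : strictOn (insert r P) lt')
    (hcompat : ∀ a b, lt a b ↔ (lt' a b ∧ a ∈ P ∧ b ∈ P))
    (X : Set (Lit (OAtom α N)))
    (hpres : staticPreserving P lt X) (hbody : ¬ r.bodyP ⊆ X) :
    staticPreserving (insert r P) lt' X := by
  obtain ⟨hans, hcons, l, henum, hground, horder, hblock⟩ := hpres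
  have hmem : ∀ (i : ℕ) (hi : i < l.length), l.get ⟨i, hi⟩ ∈ P := fun i hi =>
    (henum.2.subset (l.get_mem ⟨i, hi⟩)).1
  refine ⟨answerSet_insert hans hcons hbody, hcons, l, ?_, hground, ?_, ?_⟩
  · rwa [GR_insert hbody]
  · intro i j hi hj h
    exact horder i j hi hj ((hcompat _ _).2 ⟨h, hmem i hi, hmem j hj⟩)
  · intro i hi s hs hgr h
    rw [GR_insert hbody] at hgr
    obtain rfl | hs := hs
    · exact Or.inl hbody
    · exact hblock i hi s hs hgr ((hcompat _ _).2 ⟨h, hmem i hi, hs⟩)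

end ASP
end
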